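/- Fix a positive integer R, and let f, g : ℕ → ℕ be functions with f(n)·(log log n)/(log n) → 0 and g(n)/(log n) → 0 as n → ∞ (i.e., f(n) = o(log n / log log n) and g(n) = o(log n)). Then the set of integers n ≥ 2 for which there exists a multiple temperature tile system with temperature range at most R, tile complexity at most f(n), and temperature complexity at most g(n) that uniquely assembles the n × n square has natural density 0. In particular, for almost all n, no tile system with constant-bounded temperature range that uniquely assembles an n × n square can simultaneously have tile complexity o(log n / log log n) and temperature complexity o(log n). -/

import Mathlib

/-! ## The multiple temperature tile self-assembly model -/

/-- Glues are drawn from a countable alphabet; glue `0` is the distinguished `null` glue. -/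
abbrev Glue := ℕ

/-- A tile is a quadruple of glues (north, east, south, west). -/
structure Tile where
  north : Glue
  east : Glue
  south : Glue
  west : Glue
deriving DecidableEq

/-- A configuration maps positions of `ℤ²` to a tile or to `none` (the empty tile). -/
abbrev Config := ℤ × ℤ → Option Tile

/-- Two abutting edges bond with strength `G x` when they carry the same glue `x`,
and with strength `0` otherwise. -/
def bond (G : Glue → ℕ) (x y : Glue) : ℕ := if x = y then G x else 0

/-- Bonding strength between the edges of tile `t` at position `p` and tile `u`
at (neighboring) position `q`. -/
def edgeBond (G : Glue → ℕ) (t u : Tile) (p q : ℤ × ℤ) : ℕ :=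
  if q = (p.1, p.2 + 1) then bond G t.north u.south
  else if q = (p.1 + 1, p.2) then bond G t.east u.west
  else if q = (p.1, p.2 - 1) then bond G t.south u.north
  else if q = (p.1 - 1, p.2) then bond G t.west u.east
  else 0

/-- The four L¹-neighbors of a position. -/
def neighbors (p : ℤ × ℤ) : List (ℤ × ℤ) :=
  [(p.1, p.2 + 1), (p.1 + 1, p.2), (p.1, p.2 - 1), (p.1 - 1, p.2)]

/-- The shape of a configuration: its set of non-empty positions. -/
def shape (C : Config) : Set (ℤ × ℤ) := {p | C p ≠ none}

/-- Total bonding strength between a tile `t` placed at position `p` and the tiles of `C`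
at the four neighboring positions. -/
def attachStrength (G : Glue → ℕ) (C : Config) (t : Tile) (p : ℤ × ℤ) : ℕ :=
  ((neighbors p).map (fun q =>
    match C q with
    | some u => edgeBond G t u p q
    | none => 0)).sum

/-- Bonding strength between the tiles of `C` at adjacent positions `p` and `q`. -/
def bondAt (G : Glue → ℕ) (C : Config) (p q : ℤ × ℤ) : ℕ :=
  match C p, C q with
  | some t, some u => edgeBond G t u p q
  | _, _ => 0

/-- Total strength of the bonds from `p ∈ Q` leaving the set `Q` in configuration `C`. -/
def outStrength (G : Glue → ℕ) (C : Config) (Q : Finset (ℤ × ℤ)) (p : ℤ × ℤ) : ℕ :=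
  (((neighbors p).filter (fun q => q ∉ Q)).map (fun q => bondAt G C p q)).sum

/-- Strength of the cut of (the adjacency graph of) `C` separating `Q` from its complement:
the sum over crossing edges of the bonding strengths of the corresponding abutting edges. -/
def cutStrength (G : Glue → ℕ) (C : Config) (Q : Finset (ℤ × ℤ)) : ℕ :=
  ∑ p ∈ Q, outStrength G C Q p

/-- The initial configuration: the seed tile `s` at the origin. -/
def seedConfig (s : Tile) : Config := fun p => if p = (0, 0) then some s else none

/-- One step of assembly of the (standard) multiple temperature model at temperature `τ`:
either a tile of `T` attaches at an empty position with total bonding strength at least `τ`,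
or the portion `Q` of the supertile on the non-seed side of a cut of strength `< τ`
is removed. -/
inductive Step (T : Finset Tile) (G : Glue → ℕ) (τ : ℕ) : Config → Config → Prop
  | attach (C : Config) (t : Tile) (p : ℤ × ℤ) :
      t ∈ T → C p = none → τ ≤ attachStrength G C t p →
      Step T G τ C (Function.update C p (some t))
  | detach (C : Config) (Q : Finset (ℤ × ℤ)) :
      Q.Nonempty → ((0, 0) : ℤ × ℤ) ∉ Q → (↑Q : Set (ℤ × ℤ)) ⊆ shape C →
      cutStrength G C Q < τ →
      Step T G τ C (fun q => if q ∈ Q then none else C q)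

/-- A configuration is terminal for a step relation if no step applies. -/
def Terminal (step : Config → Config → Prop) (C : Config) : Prop := ∀ D, ¬ step C D

/-- A phase finishes from `C`: there is no infinite sequence of steps starting at `C`. -/
def PhaseTerminates (step : Config → Config → Prop) (C : Config) : Prop :=
  ¬ ∃ f : ℕ → Config, f 0 = C ∧ ∀ n, step (f n) (f (n + 1))

/-- `MultiReach step τs C E`: starting from `C`, running each phase (one per temperature
in `τs`) to a terminal configuration can produce `E`. -/
inductive MultiReach (step : ℕ → Config → Config → Prop) : List ℕ → Config → Config → Prop
  | nil {C : Config} : MultiReach step [] C C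
  | cons {τ : ℕ} {τs : List ℕ} {C D E : Config} :
      Relation.ReflTransGen (step τ) C D → Terminal (step τ) D →
      MultiReach step τs D E → MultiReach step (τ :: τs) C E

/-- Every phase finishes, no matter which additions and removals are chosen. -/
inductive AllFinish (step : ℕ → Config → Config → Prop) : List ℕ → Config → Prop
  | nil {C : Config} : AllFinish step [] C
  | cons {τ : ℕ} {τs : List ℕ} {C : Config} :
      PhaseTerminates (step τ) C →
      (∀ D, Relation.ReflTransGen (step τ) C D → Terminal (step τ) D → AllFinish step τs D) →
      AllFinish step (τ :: τs) C

/-- The tile system with seed `s` and temperature sequence `τs` uniquely produces the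
configuration (supertile) `R`: all phases always finish, and every terminal configuration
produced after the last phase equals `R`. -/
def UniquelyProduces (step : ℕ → Config → Config → Prop) (s : Tile) (τs : List ℕ)
    (R : Config) : Prop :=
  AllFinish step τs (seedConfig s) ∧
  MultiReach step τs (seedConfig s) R ∧
  ∀ C, MultiReach step τs (seedConfig s) C → C = R

/-- Translation of a set of positions by `d`. -/
def translateSet (d : ℤ × ℤ) (S : Set (ℤ × ℤ)) : Set (ℤ × ℤ) := (fun p => p + d) '' S

/-- The system uniquely assembles the shape `Υ` (up to translation). -/
def UniquelyAssembles (step : ℕ → Config → Config → Prop) (s : Tile) (τs : List ℕ)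
    (Υ : Set (ℤ × ℤ)) : Prop :=
  ∃ R : Config, UniquelyProduces step s τs R ∧ ∃ d : ℤ × ℤ, shape R = translateSet d Υ

/-- The `n × n` square shape `{0,…,n−1} × {0,…,n−1}`. -/
def square (n : ℕ) : Set (ℤ × ℤ) :=
  {p : ℤ × ℤ | 0 ≤ p.1 ∧ p.1 < (n : ℤ) ∧ 0 ≤ p.2 ∧ p.2 < (n : ℤ)}

/-- The `a × b` rectangle shape `{0,…,b−1} × {0,…,a−1}` (`b` columns, `a` rows). -/
def rect (a b : ℕ) : Set (ℤ × ℤ) :=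
  {p : ℤ × ℤ | 0 ≤ p.1 ∧ p.1 < (b : ℤ) ∧ 0 ≤ p.2 ∧ p.2 < (a : ℤ)}

/-- A set of naturals has natural density 0. -/
def HasDensityZero (A : Set ℕ) : Prop :=
  Filter.Tendsto (fun N : ℕ => (Nat.card ↥(A ∩ Set.Icc 1 N) : ℝ) / N)
    Filter.atTop (nhds 0)

namespace TileCount

def side (d : Fin 4) (t : Tile) : Glue :=
  match d with
  | 0 => t.north
  | 1 => t.east
  | 2 => t.south
  | 3 => t.west

def real {F : ℕ} (a : Fin F → Tile) (c : ℤ × ℤ → Option (Fin F)) : Config :=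
  fun p => (c p).map a

def Compat {F : ℕ} (R : ℕ) (a a' : Fin F → Tile) (G G' : Glue → ℕ) : Prop :=
  ∀ i j d d', min R (bond G (side d (a i)) (side d' (a j))) =
    min R (bond G' (side d (a' i)) (side d' (a' j)))

lemma min_add_congr {R a b a' b' : ℕ} (h : min R a = min R a') (h' : min R b = min R b') :
    min R (a + b) = min R (a' + b') := by omega

lemma min_list_sum {α : Type*} {R : ℕ} (l : List α) (f f' : α → ℕ)
    (h : ∀ q, min R (f q) = min R (f' q)) :
    min R (l.map f).sum = min R (l.map f').sum := by
  induction l with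
  | nil => rfl
  | cons x l ih =>
    simp only [List.map_cons, List.sum_cons]
    exact min_add_congr (h x) ih

lemma min_finset_sum {α : Type*} {R : ℕ} (l : Finset α) (f f' : α → ℕ)
    (h : ∀ q, min R (f q) = min R (f' q)) :
    min R (∑ x ∈ l, f x) = min R (∑ x ∈ l, f' x) := by
  classical
  induction l using Finset.induction_on with
  | empty => rfl
  | insert x l hx ih =>
    rw [Finset.sum_insert hx, Finset.sum_insert hx]
    exact min_add_congr (h x) ih

lemma min_edgeBond {F R : ℕ} {a a' : Fin F → Tile} {G G' : Glue → ℕ}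
    (h : Compat R a a' G G') (i j : Fin F) (p q : ℤ × ℤ) :
    min R (edgeBond G (a i) (a j) p q) = min R (edgeBond G' (a' i) (a' j) p q) := by
  unfold edgeBond
  split_ifs
  · exact h i j 0 2
  · exact h i j 1 3
  · exact h i j 2 0
  · exact h i j 3 1
  · rfl

lemma min_attach {F R : ℕ} {a a' : Fin F → Tile} {G G' : Glue → ℕ}
    (h : Compat R a a' G G') (c : ℤ × ℤ → Option (Fin F)) (i : Fin F) (p : ℤ × ℤ) :
    min R (attachStrength G (real a c) (a i) p) =
      min R (attachStrength G' (real a' c) (a' i) p) := by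
  unfold attachStrength
  apply min_list_sum
  intro q
  unfold real
  cases hq : c q with
  | none => simp
  | some j => simpa using min_edgeBond h i j p q

lemma min_cut {F R : ℕ} {a a' : Fin F → Tile} {G G' : Glue → ℕ}
    (h : Compat R a a' G G') (c : ℤ × ℤ → Option (Fin F)) (Q : Finset (ℤ × ℤ)) :
    min R (cutStrength G (real a c) Q) = min R (cutStrength G' (real a' c) Q) := by
  unfold cutStrength
  apply min_finset_sum
  intro p
  unfold outStrength
  apply min_list_sum
  intro q
  unfold bondAt real
  cases hp : c p with
  | none => simp
  | some i =>
    cases hq : c q with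
    | none => simp
    | some j => simpa using min_edgeBond h i j p q

lemma shape_real {F : ℕ} (a : Fin F → Tile) (c : ℤ × ℤ → Option (Fin F)) :
    shape (real a c) = {p | c p ≠ none} := by
  ext p
  simp [shape, real]

lemma step_forth {F R τ : ℕ} (hτ : τ ≤ R) {a a' : Fin F → Tile} {G G' : Glue → ℕ}
    (h : Compat R a a' G G') (c : ℤ × ℤ → Option (Fin F)) (D : Config)
    (hs : Step (Finset.univ.image a) G τ (real a c) D) :
    ∃ c', D = real a c' ∧ Step (Finset.univ.image a') G' τ (real a' c) (real a' c') := by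
  generalize hC : real a c = C at hs
  cases hs with
  | attach t p ht hp hatt =>
    subst hC
    obtain ⟨i, -, rfl⟩ := Finset.mem_image.1 ht
    have hcp : c p = none := by simpa [real] using hp
    have key : ∀ b : Fin F → Tile, Function.update (real b c) p (some (b i)) =
        real b (Function.update c p (some i)) := by
      intro b
      funext q
      by_cases hq : q = p
      · subst hq; simp [real]
      · simp [real, hq]
    refine ⟨Function.update c p (some i), key a, ?_⟩
    rw [← key a']
    refine Step.attach _ _ _ (Finset.mem_image_of_mem _ (Finset.mem_univ _)) ?_ ?_
    · simp [real, hcp]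
    · have := min_attach h c i p
      omega
  | detach Q hQ h0 hsub hcut =>
    subst hC
    have key : ∀ b : Fin F → Tile, (fun q => if q ∈ Q then none else real b c q) =
        real b (fun q => if q ∈ Q then none else c q) := by
      intro b
      funext q
      by_cases hq : q ∈ Q <;> simp [real, hq]
    refine ⟨fun q => if q ∈ Q then none else c q, key a, ?_⟩
    rw [← key a']
    refine Step.detach _ _ hQ h0 ?_ ?_
    · rw [shape_real] at hsub ⊢
      exact hsub
    · have := min_cut h c Q
      omega

lemma compat_symm {F R : ℕ} {a a' : Fin F → Tile} {G G' : Glue → ℕ}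
    (h : Compat R a a' G G') : Compat R a' a G' G := fun i j d d' => (h i j d d').symm

lemma reach_forth {F R τ : ℕ} (hτ : τ ≤ R) {a a' : Fin F → Tile} {G G' : Glue → ℕ}
    (h : Compat R a a' G G') (c : ℤ × ℤ → Option (Fin F)) (D : Config)
    (hs : Relation.ReflTransGen (Step (Finset.univ.image a) G τ) (real a c) D) :
    ∃ c', D = real a c' ∧
      Relation.ReflTransGen (Step (Finset.univ.image a') G' τ) (real a' c) (real a' c') := by
  induction hs with
  | refl => exact ⟨c, rfl, Relation.ReflTransGen.refl⟩
  | tail _ hst ih =>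
    obtain ⟨c1, rfl, h1⟩ := ih
    obtain ⟨c2, rfl, h2⟩ := step_forth hτ h c1 _ hst
    exact ⟨c2, rfl, h1.tail h2⟩

lemma multi_forth {F R : ℕ} {a a' : Fin F → Tile} {G G' : Glue → ℕ}
    (h : Compat R a a' G G') (τs : List ℕ) (hτ : ∀ τ ∈ τs, τ ≤ R)
    (c : ℤ × ℤ → Option (Fin F)) (E : Config)
    (hs : MultiReach (Step (Finset.univ.image a) G) τs (real a c) E) :
    ∃ c', E = real a c' ∧
      MultiReach (Step (Finset.univ.image a') G') τs (real a' c) (real a' c') := by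
  induction τs generalizing c with
  | nil =>
    cases hs
    exact ⟨c, rfl, MultiReach.nil⟩
  | cons τ τs ih =>
    cases hs with
    | cons h1 h2 h3 =>
      have ht : τ ≤ R := hτ τ (by simp)
      obtain ⟨c1, rfl, h1'⟩ := reach_forth ht h c _ h1
      obtain ⟨c2, rfl, h3'⟩ := ih (fun t ht => hτ t (by simp [ht])) c1 h3
      refine ⟨c2, rfl, MultiReach.cons h1' ?_ h3'⟩
      intro D hD
      obtain ⟨c3, -, h4⟩ := step_forth ht (compat_symm h) c1 D hD
      exact h2 _ h4

lemma seed_real {F : ℕ} (a : Fin F → Tile) (i : Fin F) :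
    seedConfig (a i) = real a (fun p => if p = (0, 0) then some i else none) := by
  funext p
  by_cases hp : p = (0, 0) <;> simp [seedConfig, real, hp]

lemma ncard_square (n : ℕ) : (square n).ncard = n * n := by
  have : square n = ↑((Finset.Ico (0:ℤ) n) ×ˢ (Finset.Ico (0:ℤ) n)) := by
    ext p
    simp [square, and_assoc]
  rw [this, Set.ncard_coe_finset]
  simp

lemma translate_inj {n m : ℕ} {d e : ℤ × ℤ}
    (h : translateSet d (square n) = translateSet e (square m)) : n = m := by
  have h1 : ∀ (d : ℤ × ℤ) (k : ℕ), (translateSet d (square k)).ncard = k * k := by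
    intro d k
    rw [translateSet, Set.ncard_image_of_injective _ (add_left_injective d), ncard_square]
  have := congrArg Set.ncard h
  rw [h1, h1] at this
  exact Nat.mul_self_inj.1 this

lemma system_inj {F R : ℕ} {a a' : Fin F → Tile} {G G' : Glue → ℕ}
    (h : Compat R a a' G G') (τs : List ℕ) (hτ : ∀ τ ∈ τs, τ ≤ R) (i : Fin F) {n m : ℕ}
    (h1 : UniquelyAssembles (Step (Finset.univ.image a) G) (a i) τs (square n))
    (h2 : UniquelyAssembles (Step (Finset.univ.image a') G') (a' i) τs (square m)) :
    n = m := by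
  obtain ⟨E, ⟨-, hE, -⟩, d, hd⟩ := h1
  obtain ⟨E', ⟨-, -, hE'⟩, d', hd'⟩ := h2
  rw [seed_real] at hE
  obtain ⟨c, rfl, hc⟩ := multi_forth h τs hτ _ _ hE
  rw [← seed_real] at hc
  have := hE' _ hc
  subst this
  rw [shape_real] at hd hd'
  exact translate_inj (hd.symm.trans hd')

abbrev Code (F R k : ℕ) : Type :=
  (Fin F × Fin 4 → Fin F × Fin 4) × (Fin F × Fin 4 → Fin (R + 1)) × Fin F × (Fin k → Fin (R + 1))

def gl {F : ℕ} (a : Fin F → Tile) : Fin F × Fin 4 → Glue := fun x => side x.2 (a x.1)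

noncomputable def lab {F : ℕ} (a : Fin F → Tile) (x : Fin F × Fin 4) : Fin F × Fin 4 :=
  haveI : Nonempty (Fin F × Fin 4) := ⟨x⟩
  Function.invFun (gl a) (gl a x)

lemma lab_eq {F : ℕ} (a : Fin F → Tile) (x y : Fin F × Fin 4) :
    lab a x = lab a y ↔ gl a x = gl a y := by
  have : Nonempty (Fin F × Fin 4) := ⟨x⟩
  constructor
  · intro h
    have h1 : gl a (lab a x) = gl a x := Function.invFun_eq ⟨x, rfl⟩
    have h2 : gl a (lab a y) = gl a y := Function.invFun_eq ⟨y, rfl⟩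
    rw [← h1, ← h2, h]
  · intro h
    simp [lab, h]

noncomputable def code {F : ℕ} (R k : ℕ) (a : Fin F → Tile) (G : Glue → ℕ) (i : Fin F)
    (τs : List ℕ) : Code F R k :=
  (lab a, fun x => ⟨min R (G (gl a x)), by omega⟩, i, fun j => ⟨min R (τs.getD j 0), by omega⟩)

lemma list_eq {R k : ℕ} {l l' : List ℕ} (h : ∀ τ ∈ l, 1 ≤ τ ∧ τ ≤ R)
    (h' : ∀ τ ∈ l', 1 ≤ τ ∧ τ ≤ R) (hl : l.length ≤ k) (hl' : l'.length ≤ k)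
    (he : ∀ j < k, min R (l.getD j 0) = min R (l'.getD j 0)) : l = l' := by
  apply List.ext_getElem?
  intro j
  by_cases hj : j < k
  · have := he j hj
    rw [List.getD_eq_getElem?_getD, List.getD_eq_getElem?_getD] at this
    cases h1 : l[j]? with
    | none =>
      cases h2 : l'[j]? with
      | none => rfl
      | some y =>
        have hy := h' y (List.mem_of_getElem? h2)
        exfalso
        rw [h1, h2] at this
        simp only [Option.getD_some, Option.getD_none] at this
        omega
    | some x =>
      have hx := h x (List.mem_of_getElem? h1)
      cases h2 : l'[j]? with
      | none =>
        exfalso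
        rw [h1, h2] at this
        simp only [Option.getD_some, Option.getD_none] at this
        omega
      | some y =>
        have := h' y (List.mem_of_getElem? h2)
        simp_all
  · rw [List.getElem?_eq_none (by omega), List.getElem?_eq_none (by omega)]

lemma code_compat {F R k : ℕ} {a a' : Fin F → Tile} {G G' : Glue → ℕ} {i i' : Fin F}
    {l l' : List ℕ} (h : code R k a G i l = code R k a' G' i' l') : Compat R a a' G G' := by
  simp only [code, Prod.mk.injEq] at h
  obtain ⟨h1, h2, -, -⟩ := h
  intro x y d d'
  have e : gl a (x, d) = gl a (y, d') ↔ gl a' (x, d) = gl a' (y, d') := by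
    rw [← lab_eq, ← lab_eq, h1]
  have e2 := congrArg Fin.val (congrFun h2 (x, d))
  simp only [gl] at e e2
  unfold bond
  by_cases hh : side d (a x) = side d' (a y)
  · rw [if_pos hh, if_pos (e.1 hh)]
    exact e2
  · rw [if_neg hh, if_neg (fun q => hh (e.2 q))]

/-- the property of `n`, with bounds `F`, `k`. -/
def Good (R F k n : ℕ) : Prop :=
  ∃ (T : Finset Tile) (s : Tile) (G : Glue → ℕ) (τs : List ℕ),
        s ∈ T ∧ G 0 = 0 ∧ (∀ τ ∈ τs, 1 ≤ τ ∧ τ ≤ R) ∧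
        T.card ≤ F ∧ τs.length ≤ k ∧
        UniquelyAssembles (Step T G) s τs (square n)

lemma exists_enum {T : Finset Tile} {s : Tile} (hs : s ∈ T) {F : ℕ} (hF : T.card ≤ F) :
    ∃ a : Fin F → Tile, Finset.univ.image a = T := by
  classical
  have e := T.equivFin
  refine ⟨fun i => if h : i.1 < T.card then (e.symm ⟨i.1, h⟩).1 else s, ?_⟩
  ext t
  simp only [Finset.mem_image, Finset.mem_univ, true_and]
  constructor
  · rintro ⟨i, rfl⟩
    split_ifs
    · exact Subtype.prop _
    · exact hs
  · intro ht
    refine ⟨⟨(e ⟨t, ht⟩).1, lt_of_lt_of_le (e ⟨t, ht⟩).2 hF⟩, ?_⟩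
    simp

lemma good_enum {R F k n : ℕ} (h : Good R F k n) :
    ∃ (a : Fin F → Tile) (G : Glue → ℕ) (i : Fin F) (τs : List ℕ),
      (∀ τ ∈ τs, 1 ≤ τ ∧ τ ≤ R) ∧ τs.length ≤ k ∧
      UniquelyAssembles (Step (Finset.univ.image a) G) (a i) τs (square n) := by
  obtain ⟨T, s, G, τs, hs, -, h1, h2, h3, h4⟩ := h
  obtain ⟨a, rfl⟩ := exists_enum hs h2
  obtain ⟨i, -, rfl⟩ := Finset.mem_image.1 hs
  exact ⟨a, G, i, τs, h1, h3, h4⟩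

lemma good_card (R F k : ℕ) (S : Finset ℕ) (hS : ∀ n ∈ S, Good R F k n) :
    S.card ≤ Fintype.card (Code F R k) := by
  classical
  choose a G i τs h1 h2 h3 using fun n : S => good_enum (hS n.1 n.2)
  rw [← Fintype.card_coe S]
  refine Fintype.card_le_of_injective
    (fun n => code R k (a n) (G n) (i n) (τs n)) ?_
  intro n m hnm
  have hc := code_compat hnm
  simp only [code, Prod.mk.injEq] at hnm
  obtain ⟨-, -, hi, hl⟩ := hnm
  have hl' : τs n = τs m := list_eq (h1 n) (h1 m) (h2 n) (h2 m)
    (fun j hj => congrArg Fin.val (congrFun hl ⟨j, hj⟩))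
  have hm := h3 m
  rw [← hi, ← hl'] at hm
  exact Subtype.ext (system_inj hc (τs n) (fun τ h => (h1 n τ h).2) (i n) (h3 n) hm)

lemma code_card_le (R F k B : ℕ) (hB : 4 * (R + 1) * F ≤ B) (h2 : 2 ≤ B) :
    Fintype.card (Code F R k) ≤ B ^ (5 * F) * (R + 1) ^ k := by
  have h : Fintype.card (Code F R k) =
      (4 * (R + 1) * F) ^ (4 * F) * F * (R + 1) ^ k := by
    simp only [Code, Fintype.card_prod, Fintype.card_fun, Fintype.card_fin]
    rw [mul_comm F 4, show 4 * (R + 1) * F = (4 * F) * (R + 1) by ring, mul_pow (4 * F) (R + 1)]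
    ring
  rw [h, show 5 * F = 4 * F + F by ring, pow_add]
  have h3 : F ≤ B ^ F := (Nat.lt_pow_self (by omega)).le
  gcongr

open Filter Real in
lemma main_bound (R : ℕ) (f g : ℕ → ℕ)
    (hf : Filter.Tendsto
      (fun n : ℕ => (f n : ℝ) * Real.log (Real.log n) / Real.log n) Filter.atTop (nhds 0))
    (hg : Filter.Tendsto (fun n : ℕ => (g n : ℝ) / Real.log n) Filter.atTop (nhds 0)) :
    ∀ᶠ N : ℕ in atTop, ∀ S : Finset ℕ,
      (∀ n ∈ S, n ≤ N ∧ N ≤ n * n ∧ Good R (f n) (g n) n) → (S.card : ℝ) ≤ √N := by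
  set ε : ℝ := 1 / (80 * (1 + Real.log (R + 1))) with hε
  have hlR : 0 ≤ Real.log ((R : ℝ) + 1) := Real.log_nonneg (by simp)
  have hε0 : 0 < ε := by positivity
  have hε1 : 80 * ε ≤ 1 := by
    rw [hε]
    rw [mul_one_div, div_le_one (by positivity)]
    linarith
  have hε2 : ε * Real.log (R + 1) ≤ 1 / 4 := by
    rw [hε, one_div_mul_eq_div, div_le_iff₀ (by positivity)]
    linarith
  have ef := (hf.eventually_lt_const hε0)
  have eg := (hg.eventually_lt_const hε0)
  obtain ⟨n0, hn0⟩ := eventually_atTop.1 (ef.and eg)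
  have tl : Tendsto (fun N : ℕ => Real.log N) atTop atTop :=
    Real.tendsto_log_atTop.comp tendsto_natCast_atTop_atTop
  have tll : Tendsto (fun N : ℕ => Real.log (Real.log N)) atTop atTop :=
    Real.tendsto_log_atTop.comp tl
  filter_upwards [tl.eventually_ge_atTop (4 * (R + 1) + 4), tll.eventually_ge_atTop 2,
    eventually_ge_atTop (n0 * n0 + 2)] with N hL hLL hN S hS
  set L := Real.log N with hLdef
  set M := Real.log L with hMdef
  have hR0 : (0 : ℝ) ≤ R := Nat.cast_nonneg R
  have hL0 : 0 < L := by linarith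
  have hNpos : (0 : ℝ) < N := by
    have : 0 < N := by omega
    exact_mod_cast this
  have hlog2 : Real.log 2 ≤ 1 := by linarith [Real.log_two_lt_d9]
  -- bounds for n
  have hn : ∀ n ∈ S, (f n : ℝ) ≤ 2 * ε * L / M ∧ (g n : ℝ) ≤ ε * L := by
    intro n hnS
    obtain ⟨h1, h2, -⟩ := hS n hnS
    have hnn0 : n0 ≤ n := by
      by_contra hlt
      push Not at hlt
      have : n * n ≤ n0 * n0 := Nat.mul_le_mul hlt.le hlt.le
      omega
    obtain ⟨hf1, hg1⟩ := hn0 n hnn0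
    have hnpos : (0 : ℝ) < n := by
      have : 0 < n := by
        rcases Nat.eq_zero_or_pos n with h | h
        · subst h; omega
        · exact h
      exact_mod_cast this
    have l1 : Real.log n ≤ L := Real.log_le_log hnpos (by exact_mod_cast h1)
    have l2 : L ≤ 2 * Real.log n := by
      have : L ≤ Real.log ((n : ℝ) * n) := Real.log_le_log hNpos (by exact_mod_cast h2)
      rw [Real.log_mul hnpos.ne' hnpos.ne'] at this
      linarith
    have l0 : 0 < Real.log n := by linarith
    have m2 : M ≤ Real.log 2 + Real.log (Real.log n) := by
      rw [← Real.log_mul (by norm_num) l0.ne']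
      exact Real.log_le_log hL0 l2
    have m3 : M / 2 ≤ Real.log (Real.log n) := by linarith
    rw [div_lt_iff₀ l0] at hf1 hg1
    constructor
    · rw [le_div_iff₀ (by linarith)]
      have : (f n : ℝ) * (M / 2) ≤ f n * Real.log (Real.log n) := by gcongr
      have : ε * Real.log n ≤ ε * L := by gcongr
      linarith
    · have : ε * Real.log n ≤ ε * L := by gcongr
      linarith
  set F := ⌊2 * ε * L / M⌋₊ with hF
  set k := ⌊ε * L⌋₊ with hk
  set B := ⌊L ^ 2⌋₊ with hB
  have hFle : (F : ℝ) ≤ 2 * ε * L / M := Nat.floor_le (by positivity)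
  have hkle : (k : ℝ) ≤ ε * L := Nat.floor_le (by positivity)
  have hBle : (B : ℝ) ≤ L ^ 2 := Nat.floor_le (by positivity)
  have hFM : (F : ℝ) * M ≤ 2 * ε * L := by
    rwa [le_div_iff₀ (by linarith)] at hFle
  have hFL : (F : ℝ) ≤ L := by
    have : (F : ℝ) * 1 ≤ F * M := by gcongr; linarith
    have : 2 * ε * L ≤ 1 * L := by gcongr; linarith
    linarith
  have hgood : ∀ n ∈ S, Good R F k n := by
    intro n hnS
    obtain ⟨T, s, G, τs, a1, a2, a3, a4, a5, a6⟩ := (hS n hnS).2.2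
    obtain ⟨b1, b2⟩ := hn n hnS
    exact ⟨T, s, G, τs, a1, a2, a3, a4.trans (Nat.le_floor b1), a5.trans (Nat.le_floor b2), a6⟩
  have hB1 : 4 * (R + 1) * F ≤ B := by
    apply Nat.le_floor
    push_cast
    rw [sq]
    gcongr
    linarith
  have hB2 : 2 ≤ B := by
    apply Nat.le_floor
    push_cast
    nlinarith
  have hcard := (good_card R F k S hgood).trans (code_card_le R F k B hB1 hB2)
  have hcard' : (S.card : ℝ) ≤ (B : ℝ) ^ (5 * F) * ((R : ℝ) + 1) ^ k := by
    exact_mod_cast hcard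
  have hBpos : (0 : ℝ) < B := by
    have : 0 < B := by omega
    exact_mod_cast this
  have hlogB : Real.log B ≤ 2 * M := by
    have := Real.log_le_log hBpos hBle
    rwa [Real.log_pow] at this
  refine hcard'.trans ?_
  rw [Real.le_sqrt' (by positivity), ← Real.log_le_log_iff (by positivity) hNpos, Real.log_pow,
    Real.log_mul (by positivity) (by positivity), Real.log_pow, Real.log_pow]
  push_cast
  have c1 : (F : ℝ) * Real.log B ≤ F * (2 * M) := by gcongr
  have c2 : (k : ℝ) * Real.log (R + 1) ≤ (ε * L) * Real.log (R + 1) := by gcongr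
  have c3 : (ε * Real.log (R + 1)) * L ≤ 1 / 4 * L := by gcongr
  have c4 : (80 * ε) * L ≤ 1 * L := by gcongr
  change _ ≤ L
  nlinarith

end TileCount

/-- Fix a temperature range bound `R` and functions
`f(n) = o(log n / log log n)`, `g(n) = o(log n)`. The set of `n ≥ 2` admitting a multiple
temperature tile system with temperature range at most `R`, tile complexity at most `f n`,
and temperature complexity at most `g n` that uniquely assembles the `n × n` square has
natural density 0. -/
theorem stmt2 (R : ℕ) (hR : 0 < R) (f g : ℕ → ℕ)
    (hf : Filter.Tendsto
      (fun n : ℕ => (f n : ℝ) * Real.log (Real.log n) / Real.log n) Filter.atTop (nhds 0))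
    (hg : Filter.Tendsto (fun n : ℕ => (g n : ℝ) / Real.log n) Filter.atTop (nhds 0)) :
    HasDensityZero {n : ℕ | 2 ≤ n ∧
      ∃ (T : Finset Tile) (s : Tile) (G : Glue → ℕ) (τs : List ℕ),
        s ∈ T ∧ G 0 = 0 ∧ (∀ τ ∈ τs, 1 ≤ τ ∧ τ ≤ R) ∧
        T.card ≤ f n ∧ τs.length ≤ g n ∧
        UniquelyAssembles (Step T G) s τs (square n)} := by
  classical
  have hb := TileCount.main_bound R f g hf hg
  have h0 : Filter.Tendsto (fun N : ℕ => (3 : ℝ) * (√(N : ℝ))⁻¹) Filter.atTop (nhds 0) := by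
    have := ((Real.tendsto_sqrt_atTop.comp
      (tendsto_natCast_atTop_atTop (R := ℝ))).inv_tendsto_atTop).const_mul (3 : ℝ)
    simpa using this
  unfold HasDensityZero
  refine squeeze_zero' (Filter.Eventually.of_forall fun N => by positivity) ?_ h0
  filter_upwards [hb, Filter.eventually_ge_atTop 1] with N hN hN1
  set A : Set ℕ := {n : ℕ | 2 ≤ n ∧
      ∃ (T : Finset Tile) (s : Tile) (G : Glue → ℕ) (τs : List ℕ),
        s ∈ T ∧ G 0 = 0 ∧ (∀ τ ∈ τs, 1 ≤ τ ∧ τ ≤ R) ∧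
        T.card ≤ f n ∧ τs.length ≤ g n ∧
        UniquelyAssembles (Step T G) s τs (square n)} with hA
  have hfin : (A ∩ Set.Icc 1 N).Finite := (Set.finite_Icc 1 N).inter_of_right _
  set S := hfin.toFinset with hS
  have hcard : Nat.card ↥(A ∩ Set.Icc 1 N) = S.card := Nat.card_eq_card_finite_toFinset hfin
  have hmem : ∀ n, n ∈ S ↔ n ∈ A ∧ 1 ≤ n ∧ n ≤ N := by
    intro n
    simp [hS]
  rw [hcard]
  have hsplit := S.card_filter_add_card_filter_not (fun n => N ≤ n * n)
  have b1 := hN (S.filter (fun n => N ≤ n * n)) (by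
    intro n hn
    rw [Finset.mem_filter, hmem] at hn
    exact ⟨hn.1.2.2, hn.2, hn.1.1.2⟩)
  have b2 : (S.filter (fun n => ¬ N ≤ n * n)).card ≤ Nat.sqrt N + 1 := by
    rw [← Finset.card_range (Nat.sqrt N + 1)]
    apply Finset.card_le_card
    intro n hn
    rw [Finset.mem_filter] at hn
    rw [Finset.mem_range, Nat.lt_succ_iff, Nat.le_sqrt]
    omega
  have b3 : (Nat.sqrt N : ℝ) ≤ √(N : ℝ) := Real.nat_sqrt_le_real_sqrt
  have b4 : (1 : ℝ) ≤ √(N : ℝ) := by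
    rw [Real.one_le_sqrt]
    exact_mod_cast hN1
  have b5 : (S.card : ℝ) ≤ 3 * √(N : ℝ) := by
    have b2' : ((S.filter (fun n => ¬ N ≤ n * n)).card : ℝ) ≤ Nat.sqrt N + 1 := by
      exact_mod_cast b2
    have : (S.card : ℝ) = (S.filter (fun n => N ≤ n * n)).card +
        (S.filter (fun n => ¬ N ≤ n * n)).card := by
      exact_mod_cast hsplit.symm
    linarith
  have hNpos : (0 : ℝ) < N := by exact_mod_cast hN1
  rw [div_le_iff₀ hNpos]
  have : (√(N : ℝ))⁻¹ * N = √(N : ℝ) := by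
    rw [inv_mul_eq_div]
    exact Real.div_sqrt
  rw [mul_assoc, this]
  exact b5
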